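/- For every dimension d ≥ 1 there exists a constant C_d > 0 (one may take C_d to be the square root of the volume of the ball of radius 2 in ℝ^d, plus an absolute factor) such that for every smooth compactly supported nonnegative function h : ℝ^d → [0,∞) one has ∫_{ℝ^d} h³ dx ≤ C_d² ( (3/2) ( ∫_{ℝ^d} h |∇h|² dx )^{1/2} + ∫_{ℝ^d} h^{3/2} dx )². -/

import Mathlib

open MeasureTheory

/-- `|∇h(x)|² = ∑ⱼ |∂ⱼ h(x)|²`, the squared Euclidean length of the gradient. -/
noncomputable def gradNormSq {d : ℕ} {F : Type*} [NormedAddCommGroup F] [NormedSpace ℝ F]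
    (f : EuclideanSpace ℝ (Fin d) → F) (x : EuclideanSpace ℝ (Fin d)) : ℝ :=
  ∑ j : Fin d, ‖fderiv ℝ f x (EuclideanSpace.single j 1)‖ ^ 2

lemma aux_jensen (g : ℝ → ℝ) (hg : Continuous g) :
    ‖∫ t in (0:ℝ)..1, g t‖ₑ ^ 2 ≤ ∫⁻ t in Set.Ioc (0:ℝ) 1, ‖g t‖ₑ ^ 2 := by
  have h1 : ‖∫ t in (0:ℝ)..1, g t‖ₑ ≤ ∫⁻ t in Set.Ioc (0:ℝ) 1, ‖g t‖ₑ := by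
    rw [intervalIntegral.integral_of_le zero_le_one]
    exact enorm_integral_le_lintegral_enorm _
  have h2 := ENNReal.lintegral_mul_le_Lp_mul_Lq (volume.restrict (Set.Ioc (0:ℝ) 1))
    (p := 2) (q := 2) Real.HolderConjugate.two_two (f := fun t => ‖g t‖ₑ) (g := fun _ => 1)
    (by fun_prop) (by fun_prop)
  simp only [Pi.mul_apply, mul_one, ENNReal.one_rpow, lintegral_const, one_mul] at h2
  simp only [MeasurableSet.univ, Measure.restrict_apply, Set.univ_inter, Real.volume_Ioc, sub_zero,
    ENNReal.ofReal_one, ENNReal.one_rpow, mul_one, ENNReal.rpow_two] at h2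
  calc _ ≤ _ := pow_le_pow_left' (h1.trans h2) 2
    _ = _ := by
      rw [← ENNReal.rpow_two, ← ENNReal.rpow_mul]; norm_num

lemma aux_translate {d : ℕ} (f : EuclideanSpace ℝ (Fin d) → ℝ) (hf : ContDiff ℝ 1 f)
    (y : EuclideanSpace ℝ (Fin d)) :
    ∫⁻ x, ‖f (x + y) - f x‖ₑ ^ 2 ≤ ‖y‖ₑ ^ 2 * ∫⁻ x, ‖fderiv ℝ f x‖ₑ ^ 2 := by
  have hc : Continuous (fderiv ℝ f) := hf.continuous_fderiv one_ne_zero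
  have key : ∀ x, ‖f (x + y) - f x‖ₑ ^ 2 ≤
      ∫⁻ t in Set.Ioc (0:ℝ) 1, ‖y‖ₑ ^ 2 * ‖fderiv ℝ f (x + t • y)‖ₑ ^ 2 := by
    intro x
    have hd : ∀ t : ℝ, HasDerivAt (fun t : ℝ => f (x + t • y)) (fderiv ℝ f (x + t • y) y) t := by
      intro t
      have h1 : HasDerivAt (fun t : ℝ => x + t • y) y t := by
        simpa using ((hasDerivAt_id t).smul_const y).const_add x
      exact ((hf.differentiable one_ne_zero _).hasFDerivAt).comp_hasDerivAt t h1
    have hcg : Continuous (fun t : ℝ => fderiv ℝ f (x + t • y) y) := by fun_prop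
    have h2 := intervalIntegral.integral_eq_sub_of_hasDerivAt (a := 0) (b := 1)
      (fun t _ => hd t) (hcg.intervalIntegrable _ _)
    simp only [one_smul, zero_smul, add_zero] at h2
    rw [← h2]
    refine (aux_jensen _ hcg).trans ?_
    gcongr with t
    rw [← mul_pow]
    gcongr
    rw [mul_comm]
    exact ContinuousLinearMap.le_opENorm _ _
  calc _ ≤ ∫⁻ x, ∫⁻ t in Set.Ioc (0:ℝ) 1, ‖y‖ₑ ^ 2 * ‖fderiv ℝ f (x + t • y)‖ₑ ^ 2 :=
        lintegral_mono key
    _ = ∫⁻ t in Set.Ioc (0:ℝ) 1, ∫⁻ x, ‖y‖ₑ ^ 2 * ‖fderiv ℝ f (x + t • y)‖ₑ ^ 2 := by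
        apply lintegral_lintegral_swap
        apply Measurable.aemeasurable
        have : Continuous (fun p : EuclideanSpace ℝ (Fin d) × ℝ => fderiv ℝ f (p.1 + p.2 • y)) := by
          fun_prop
        exact (this.enorm.measurable.pow_const 2).const_mul _
    _ = ∫⁻ t in Set.Ioc (0:ℝ) 1, ‖y‖ₑ ^ 2 * ∫⁻ x, ‖fderiv ℝ f x‖ₑ ^ 2 := by
        congr 1
        ext t
        rw [lintegral_add_right_eq_self (μ := volume)
          (fun x => ‖y‖ₑ ^ 2 * ‖fderiv ℝ f x‖ₑ ^ 2) (t • y)]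
        exact lintegral_const_mul _ (hc.enorm.measurable.pow_const 2)
    _ = _ := by simp

lemma aux_main {d : ℕ} (f : EuclideanSpace ℝ (Fin d) → ℝ) (hf : ContDiff ℝ 1 f) :
    volume (Metric.ball (0 : EuclideanSpace ℝ (Fin d)) 1) * ∫⁻ x, ‖f x‖ₑ ^ 2 ≤
      volume (Metric.ball (0 : EuclideanSpace ℝ (Fin d)) 1) * (∫⁻ x, ‖fderiv ℝ f x‖ₑ ^ 2)
        + 2 * (∫⁻ x, ‖f x‖ₑ) ^ 2 := by
  have hcf : Continuous f := hf.continuous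
  have hm : Measurable (fun x => ‖f x‖ₑ) := hcf.enorm.measurable
  have hpt : ∀ a b : ℝ, ‖a‖ₑ ^ 2 ≤ ‖b - a‖ₑ ^ 2 + 2 * (‖a‖ₑ * ‖b‖ₑ) := by
    intro a b
    have : |a| ^ 2 ≤ |b - a| ^ 2 + 2 * (|a| * |b|) := by
      rw [sq_abs, sq_abs, ← abs_mul]
      nlinarith [le_abs_self (a * b), sq_nonneg b]
    simp only [Real.enorm_eq_ofReal_abs]
    rw [← ENNReal.ofReal_pow (abs_nonneg _), ← ENNReal.ofReal_pow (abs_nonneg _),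
      ← ENNReal.ofReal_mul (abs_nonneg _), show (2 : ENNReal) = ENNReal.ofReal 2 by simp,
      ← ENNReal.ofReal_mul (by norm_num), ← ENNReal.ofReal_add (by positivity) (by positivity)]
    exact ENNReal.ofReal_le_ofReal this
  have hy : ∀ y ∈ Metric.ball (0 : EuclideanSpace ℝ (Fin d)) 1,
      ∫⁻ x, ‖f x‖ₑ ^ 2 ≤ (∫⁻ x, ‖fderiv ℝ f x‖ₑ ^ 2) + ∫⁻ x, 2 * (‖f x‖ₑ * ‖f (x + y)‖ₑ) := by
    intro y hy
    have hy1 : ‖y‖ₑ ^ 2 ≤ 1 := by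
      apply pow_le_one'
      rw [← ofReal_norm]
      rw [mem_ball_zero_iff] at hy
      exact ENNReal.ofReal_le_one.2 hy.le
    have hc2 : Continuous (fun x => f (x + y) - f x) := by fun_prop
    calc _ ≤ ∫⁻ x, (‖f (x + y) - f x‖ₑ ^ 2 + 2 * (‖f x‖ₑ * ‖f (x + y)‖ₑ)) :=
          lintegral_mono fun x => hpt _ _
      _ = (∫⁻ x, ‖f (x + y) - f x‖ₑ ^ 2) + ∫⁻ x, 2 * (‖f x‖ₑ * ‖f (x + y)‖ₑ) :=
          lintegral_add_left (hc2.enorm.measurable.pow_const 2) _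
      _ ≤ _ := by
          refine add_le_add ((aux_translate f hf y).trans ?_) le_rfl
          exact mul_le_of_le_one_left' hy1
  have h1 := setLIntegral_mono' (μ := volume) (Metric.isOpen_ball.measurableSet) hy
  rw [lintegral_add_left measurable_const] at h1
  simp only [lintegral_const, Measure.restrict_apply, MeasurableSet.univ, Set.univ_inter] at h1
  rw [mul_comm, mul_comm (volume _)]
  refine h1.trans ?_
  gcongr
  calc _ ≤ ∫⁻ y, ∫⁻ x, 2 * (‖f x‖ₑ * ‖f (x + y)‖ₑ) := setLIntegral_le_lintegral _ _
    _ = ∫⁻ x, ∫⁻ y, 2 * (‖f x‖ₑ * ‖f (x + y)‖ₑ) := by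
        apply lintegral_lintegral_swap
        apply Measurable.aemeasurable
        have c1 : Continuous (fun p : EuclideanSpace ℝ (Fin d) × EuclideanSpace ℝ (Fin d) =>
          f p.2) := by fun_prop
        have c2 : Continuous (fun p : EuclideanSpace ℝ (Fin d) × EuclideanSpace ℝ (Fin d) =>
          f (p.2 + p.1)) := by fun_prop
        exact (c1.enorm.measurable.mul c2.enorm.measurable).const_mul 2
    _ = ∫⁻ x, 2 * (‖f x‖ₑ * ∫⁻ y, ‖f y‖ₑ) := by
        congr 1
        ext x
        rw [lintegral_add_left_eq_self (μ := volume) (fun y => 2 * (‖f x‖ₑ * ‖f y‖ₑ)) x,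
          lintegral_const_mul _ (hm.const_mul _), lintegral_const_mul _ hm]
    _ = _ := by
        rw [lintegral_const_mul _ (hm.mul_const _), lintegral_mul_const _ hm, sq]

lemma aux_grad {d : ℕ} (h : EuclideanSpace ℝ (Fin d) → ℝ) (x : EuclideanSpace ℝ (Fin d)) :
    ‖fderiv ℝ h x‖ ^ 2 ≤ gradNormSq h x := by
  have h0 : 0 ≤ gradNormSq h x := Finset.sum_nonneg fun _ _ => by positivity
  rw [← Real.le_sqrt (norm_nonneg _) h0]
  refine ContinuousLinearMap.opNorm_le_bound _ (Real.sqrt_nonneg _) fun v => ?_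
  have hv : fderiv ℝ h x v = ∑ j, fderiv ℝ h x (EuclideanSpace.single j 1) * v j := by
    conv_lhs => rw [← (EuclideanSpace.basisFun (Fin d) ℝ).sum_repr v]
    simp [map_sum, mul_comm]
  rw [EuclideanSpace.norm_eq v, ← Real.sqrt_mul h0, hv]
  apply Real.le_sqrt_of_sq_le
  simp only [gradNormSq, Real.norm_eq_abs, sq_abs]
  exact Finset.sum_mul_sq_le_sq_mul_sq _ _ _

lemma aux_arith {V A N I : ℝ} (hVpos : 0 < V) (hN0 : 0 ≤ N) (hI0 : 0 ≤ I)
    (hm2 : V * A ≤ V * (9 / 4 * I) + 2 * N ^ 2) :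
    A ≤ (1 + 2 / V) ^ 2 * (3 / 2 * Real.sqrt I + N) ^ 2 := by
  have hA : A ≤ 9 / 4 * I + 2 / V * N ^ 2 := by
    have : V * A ≤ V * (9 / 4 * I + 2 / V * N ^ 2) := by
      refine hm2.trans (le_of_eq ?_)
      field_simp
    exact le_of_mul_le_mul_left this hVpos
  have hw : 0 < 2 / V := by positivity
  generalize 2 / V = w at *
  have hs0 := Real.sqrt_nonneg I
  have hss := Real.sq_sqrt hI0
  generalize Real.sqrt I = s at *
  subst hss
  have hb : 9 / 4 * s ^ 2 + N ^ 2 ≤ (3 / 2 * s + N) ^ 2 := by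
    nlinarith [mul_nonneg hs0 hN0]
  have hw1 : 1 + w ≤ (1 + w) ^ 2 := by nlinarith
  calc A ≤ (1 + w) * (9 / 4 * s ^ 2 + N ^ 2) := by
        nlinarith [mul_nonneg hw.le (sq_nonneg s), sq_nonneg N]
    _ ≤ _ := by gcongr

lemma aux_enn {V A N I : ℝ} (hVpos : 0 < V) (hN0 : 0 ≤ N) (hI0 : 0 ≤ I)
    (hm2 : ENNReal.ofReal V * ENNReal.ofReal A ≤
      ENNReal.ofReal V * ENNReal.ofReal (9 / 4 * I) + 2 * ENNReal.ofReal N ^ 2) :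
    V * A ≤ V * (9 / 4 * I) + 2 * N ^ 2 := by
  rw [← ENNReal.ofReal_mul hVpos.le, ← ENNReal.ofReal_mul hVpos.le,
    ← ENNReal.ofReal_pow hN0, show (2 : ENNReal) = ENNReal.ofReal 2 by simp,
    ← ENNReal.ofReal_mul (by norm_num), ← ENNReal.ofReal_add (by positivity) (by positivity),
    ENNReal.ofReal_le_ofReal_iff (by positivity)] at hm2
  exact hm2

theorem cube_integral_bound (d : ℕ) (hd : 1 ≤ d) :
    ∃ C : ℝ, 0 < C ∧ ∀ h : EuclideanSpace ℝ (Fin d) → ℝ,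
      ContDiff ℝ (⊤ : ℕ∞) h → HasCompactSupport h → (∀ x, 0 ≤ h x) →
      ∫ x, h x ^ 3 ≤
        C ^ 2 * ((3 / 2) * (∫ x, h x * gradNormSq h x) ^ ((1 : ℝ) / 2)
          + ∫ x, h x ^ ((3 : ℝ) / 2)) ^ 2 := by
  obtain ⟨V, hV⟩ : ∃ V : ℝ, V = (volume (Metric.ball (0 : EuclideanSpace ℝ (Fin d)) 1)).toReal :=
    ⟨_, rfl⟩
  have hVtop : volume (Metric.ball (0 : EuclideanSpace ℝ (Fin d)) 1) ≠ ⊤ :=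
    measure_ball_lt_top.ne
  have hVpos : 0 < V := hV ▸
    ENNReal.toReal_pos (Metric.measure_ball_pos volume _ one_pos).ne' hVtop
  have hVe : volume (Metric.ball (0 : EuclideanSpace ℝ (Fin d)) 1) = ENNReal.ofReal V :=
    hV ▸ (ENNReal.ofReal_toReal hVtop).symm
  refine ⟨1 + 2 / V, by positivity, fun h hh hs hn => ?_⟩
  have hch : Continuous h := hh.continuous
  have hh1 : ContDiff ℝ 1 h := hh.of_le (by exact_mod_cast le_top)
  have hcd : Continuous (fderiv ℝ h) := hh1.continuous_fderiv one_ne_zero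
  set f : EuclideanSpace ℝ (Fin d) → ℝ := fun x => h x ^ ((3 : ℝ) / 2) with hfdef
  have hf : ContDiff ℝ 1 f := hh1.rpow_const_of_le (by norm_num)
  have hf0 : ∀ x, 0 ≤ f x := fun x => Real.rpow_nonneg (hn x) _
  have hfs : HasCompactSupport f := hs.comp_left (g := fun t : ℝ => t ^ ((3 : ℝ) / 2))
    (Real.zero_rpow (by norm_num))
  have hfint : Integrable f := hf.continuous.integrable_of_hasCompactSupport hfs
  have hf2 : ∀ x, f x ^ 2 = h x ^ 3 := fun x => by
    simp only [hfdef]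
    rw [← Real.rpow_natCast, ← Real.rpow_mul (hn x), ← Real.rpow_natCast]
    norm_num
  have hc3 : Continuous (fun x => h x ^ 3) := by fun_prop
  have hs3 : HasCompactSupport (fun x => h x ^ 3) := by
    refine hs.mono fun x hx => ?_
    rw [Function.mem_support] at hx ⊢
    intro h0
    apply hx
    rw [h0]
    norm_num
  have h3int : Integrable (fun x => h x ^ 3) := hc3.integrable_of_hasCompactSupport hs3
  have hgc : Continuous (gradNormSq h) := by
    unfold gradNormSq
    fun_prop
  have hg0 : ∀ x, 0 ≤ gradNormSq h x := fun x => Finset.sum_nonneg fun _ _ => by positivity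
  have hgint : Integrable (fun x => h x * gradNormSq h x) :=
    (hch.mul hgc).integrable_of_hasCompactSupport hs.mul_right
  have hdf : ∀ x, ‖fderiv ℝ f x‖ ^ 2 ≤ 9 / 4 * (h x * gradNormSq h x) := by
    intro x
    have h1 := ((hh1.differentiable one_ne_zero x).hasFDerivAt).rpow_const (p := (3:ℝ)/2)
      (Or.inr (by norm_num))
    have h2 : h x ^ ((3:ℝ) / 2 - 1) = Real.sqrt (h x) := by
      rw [Real.sqrt_eq_rpow]; norm_num
    rw [h2] at h1
    rw [h1.fderiv, norm_smul, mul_pow, Real.norm_eq_abs, sq_abs, mul_pow, Real.sq_sqrt (hn x)]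
    have := mul_le_mul_of_nonneg_left (aux_grad h x) (hn x)
    nlinarith
  have hI0 : 0 ≤ ∫ x, h x * gradNormSq h x := integral_nonneg fun x => mul_nonneg (hn x) (hg0 x)
  have hN0 : 0 ≤ ∫ x, f x := integral_nonneg hf0
  have e1 : ∫⁻ x, ‖f x‖ₑ ^ 2 = ENNReal.ofReal (∫ x, h x ^ 3) := by
    rw [ofReal_integral_eq_lintegral_ofReal h3int (.of_forall fun x => pow_nonneg (hn x) 3)]
    congr 1
    ext x
    rw [← hf2, Real.enorm_of_nonneg (hf0 x), ENNReal.ofReal_pow (hf0 x)]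
  have e2 : ∫⁻ x, ‖f x‖ₑ = ENNReal.ofReal (∫ x, f x) := by
    rw [ofReal_integral_eq_lintegral_ofReal hfint (.of_forall hf0)]
    congr 1
    ext x
    rw [Real.enorm_of_nonneg (hf0 x)]
  have e3 : ∫⁻ x, ‖fderiv ℝ f x‖ₑ ^ 2 ≤
      ENNReal.ofReal (9 / 4 * ∫ x, h x * gradNormSq h x) := by
    rw [← integral_const_mul, ofReal_integral_eq_lintegral_ofReal (hgint.const_mul _)
      (.of_forall fun x => mul_nonneg (by norm_num) (mul_nonneg (hn x) (hg0 x)))]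
    refine lintegral_mono fun x => ?_
    rw [← ofReal_norm, ← ENNReal.ofReal_pow (norm_nonneg _)]
    exact ENNReal.ofReal_le_ofReal (hdf x)
  have hmain := aux_main f hf
  rw [e1, e2, hVe] at hmain
  have hm2 := hmain.trans (add_le_add_left (mul_le_mul_right e3 _) _)
  rw [← Real.sqrt_eq_rpow]
  change _ ≤ (1 + 2 / V) ^ 2 * (3 / 2 * Real.sqrt (∫ x, h x * gradNormSq h x) + ∫ x, f x) ^ 2
  exact aux_arith hVpos hN0 hI0 (aux_enn hVpos hN0 hI0 hm2)
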